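/- Let V be a linear subspace of ℝ^N with the property that every nonzero vector in V has both a strictly positive coordinate and a strictly negative coordinate. Then there exists a vector a ∈ ℝ^N, orthogonal to V with respect to the standard inner product, all of whose coordinates are strictly positive. -/

import Mathlib

/-- If every nonzero vector of a linear subspace `V ⊆ ℝ^N` has both a strictly positive and a
strictly negative coordinate, then there is a vector with all coordinates strictly positive
which is orthogonal to `V` with respect to the standard inner product. -/
theorem exists_positive_orthogonal_vector (N : ℕ) (V : Submodule ℝ (Fin N → ℝ))
    (hV : ∀ v ∈ V, v ≠ 0 → (∃ i, 0 < v i) ∧ (∃ i, v i < 0)) :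
    ∃ a : Fin N → ℝ, (∀ i, 0 < a i) ∧ ∀ v ∈ V, ∑ i, a i * v i = 0 := by
  have hdisj : Disjoint (V : Set (Fin N → ℝ)) (stdSimplex ℝ (Fin N)) := by
    refine Set.disjoint_left.mpr fun v hv hs => ?_
    have hne : v ≠ 0 := by
      rintro rfl
      simpa using hs.2
    obtain ⟨i, hi⟩ := (hV v hv hne).2
    exact (hs.1 i).not_gt hi
  obtain ⟨f, u, w, hfV, huw, hfs⟩ := geometric_hahn_banach_closed_compact V.convex
    V.closed_of_finiteDimensional (convex_stdSimplex ℝ (Fin N))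
    (isCompact_stdSimplex ℝ (Fin N)) hdisj
  have hu : 0 < u := by simpa using hfV 0 V.zero_mem
  refine ⟨fun i => f (Pi.single i 1), fun i =>
    hu.trans (huw.trans (hfs _ (single_mem_stdSimplex ℝ i))), fun v hv => ?_⟩
  have hsum : ∑ i, f (Pi.single i 1) * v i = f v := by
    conv_rhs => rw [pi_eq_sum_univ' v, map_sum]
    refine Finset.sum_congr rfl fun i _ => ?_
    rw [map_smul, smul_eq_mul, mul_comm]
  rw [hsum]
  by_contra hne
  have h := hfV ((u / f v) • v) (V.smul_mem _ hv)
  rw [map_smul, smul_eq_mul, div_mul_cancel₀ _ hne] at h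
  exact lt_irrefl _ h
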